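/- Fix λ > 0. In the discrete-time entropy-regularized MDP, a regular relaxed feedback control π : S → D(U) is a relaxed equilibrium if and only if for every state i, π(i) maximizes ρ ↦ ∫_U (f(0,i,u) - λ ln ρ(u) + p^u_i · V^π_λ) ρ(u) du over densities ρ ∈ D(U), which holds if and only if π(i) equals the Gibbs density Γ_λ(V^π_λ, i)(u) = e^{(f(0,i,u)+p^u_i·V^π_λ)/λ}/∫_U e^{(f(0,i,v)+p^v_i·V^π_λ)/λ}dv. -/

import Mathlib

open MeasureTheory Real

noncomputable section

variable (ℓ d : ℕ) (U : Set (EuclideanSpace ℝ (Fin ℓ)))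
  (f : ℕ → Fin d → EuclideanSpace ℝ (Fin ℓ) → ℝ)
  (p : EuclideanSpace ℝ (Fin ℓ) → Fin d → Fin d → ℝ)
  (dis : ℕ → ℝ) (lam : ℝ)

/-- Shannon differential entropy of a density on `U`. -/
def Hent (ρ : EuclideanSpace ℝ (Fin ℓ) → ℝ) : ℝ := -∫ u in U, ρ u * Real.log (ρ u)

/-- Transition matrix induced by a relaxed (density-valued) feedback control `pol`. -/
def Pmat (pol : Fin d → EuclideanSpace ℝ (Fin ℓ) → ℝ) : Matrix (Fin d) (Fin d) ℝ :=
  Matrix.of fun i j => ∫ u in U, p u i j * pol i u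

/-- Entropy-regularized running reward, at "time-difference" `k`, of control `pol`. -/
def rvec (pol : Fin d → EuclideanSpace ℝ (Fin ℓ) → ℝ) (k : ℕ) : Fin d → ℝ :=
  fun i => (∫ u in U, f k i u * pol i u) + lam * dis k * Hent ℓ U (pol i)

/-- The entropy-regularized value `J_λ^pol(i) = E_i[Σ_k (f^{pol}(k,X_k) + λδ(k)H(pol(X_k)))]`. -/
def Jlam (pol : Fin d → EuclideanSpace ℝ (Fin ℓ) → ℝ) : Fin d → ℝ :=
  ∑' k : ℕ, ((Pmat ℓ d U p pol) ^ k).mulVec (rvec ℓ d U f dis lam pol k)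

/-- The auxiliary continuation value `V_λ^pol(i)`, with rewards shifted by one time step. -/
def Vlam (pol : Fin d → EuclideanSpace ℝ (Fin ℓ) → ℝ) : Fin d → ℝ :=
  ∑' k : ℕ, ((Pmat ℓ d U p pol) ^ k).mulVec (rvec ℓ d U f dis lam pol (k + 1))

/-- The value `J_λ^{pol'⊗₁pol}` of the concatenation of `pol'` (at time 0) and `pol` (from time 1 on). -/
def Jcat (pol' pol : Fin d → EuclideanSpace ℝ (Fin ℓ) → ℝ) : Fin d → ℝ :=
  fun i => rvec ℓ d U f dis lam pol' 0 i + (Pmat ℓ d U p pol').mulVec (Vlam ℓ d U f p dis lam pol) i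

/-- `pol` is a regular relaxed feedback control: each `pol i` is a probability density on `U`
with finite differential entropy. -/
def IsRegularControl (pol : Fin d → EuclideanSpace ℝ (Fin ℓ) → ℝ) : Prop :=
  ∀ i, Measurable (pol i) ∧ (∀ u ∈ U, 0 ≤ pol i u) ∧ (∀ u, u ∉ U → pol i u = 0) ∧
    (∫ u in U, pol i u) = 1 ∧ IntegrableOn (fun u => pol i u * Real.log (pol i u)) U

/-- `pol` is a relaxed equilibrium for the entropy-regularized MDP:
`J_λ^{pol'⊗₁pol}(i) ≤ J_λ^pol(i)` for all regular `pol'` and all states `i`. -/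
def IsRelaxedEquilibrium (pol : Fin d → EuclideanSpace ℝ (Fin ℓ) → ℝ) : Prop :=
  IsRegularControl ℓ d U pol ∧
  ∀ pol', IsRegularControl ℓ d U pol' → ∀ i, Jcat ℓ d U f p dis lam pol' pol i ≤ Jlam ℓ d U f p dis lam pol i

theorem aux_pt (g r : ℝ) (hg : 0 < g) (hr : 0 ≤ r) :
    (log g - log r) * r ≤ g - r ∧ ((log g - log r) * r = g - r → r = g) := by
  rcases hr.eq_or_lt with h | h
  · subst h
    constructor
    · simp [hg.le]
    · intro h; simp at h; linarith
  · have e : g - r = (g / r - 1) * r := by field_simp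
    rw [← log_div hg.ne' h.ne', e]
    constructor
    · exact mul_le_mul_of_nonneg_right (log_le_sub_one_of_pos (div_pos hg h)) h.le
    · intro h1
      have h2 := mul_right_cancel₀ h.ne' h1
      by_contra hne
      have : g / r ≠ 1 := by
        intro h3
        rw [div_eq_one_iff_eq h.ne'] at h3
        exact hne h3.symm
      exact absurd h2 (log_lt_sub_one_of_pos (div_pos hg h) this).ne

theorem aux_gibbs {α : Type*} [MeasurableSpace α] (μ : Measure α) [IsFiniteMeasure μ] [NeZero μ]
    (q : α → ℝ) (C lam : ℝ) (hlam : 0 < lam) (hq : Measurable q) (hC : ∀ᵐ u ∂μ, |q u| ≤ C) :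
    Integrable (fun u => exp (q u / lam)) μ ∧ 0 < (∫ v, exp (q v / lam) ∂μ) ∧
    ∀ ρ : α → ℝ, (∀ᵐ u ∂μ, 0 ≤ ρ u) → Integrable ρ μ → (∫ u, ρ u ∂μ) = 1 →
      Integrable (fun u => ρ u * log (ρ u)) μ →
      (∫ u, (q u - lam * log (ρ u)) * ρ u ∂μ) ≤ lam * log (∫ v, exp (q v / lam) ∂μ) ∧
      ((∫ u, (q u - lam * log (ρ u)) * ρ u ∂μ) = lam * log (∫ v, exp (q v / lam) ∂μ) ↔
        ∀ᵐ u ∂μ, ρ u = exp (q u / lam) / ∫ v, exp (q v / lam) ∂μ) := by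
  have hint : Integrable (fun u => exp (q u / lam)) μ := by
    refine Integrable.of_bound (by fun_prop) (exp (C / lam)) ?_
    filter_upwards [hC] with u hu
    rw [Real.norm_eq_abs, abs_of_pos (exp_pos _)]
    exact exp_le_exp.2 (by gcongr; exact (le_abs_self _).trans hu)
  have hZ : 0 < (∫ v, exp (q v / lam) ∂μ) := integral_exp_pos hint
  refine ⟨hint, hZ, ?_⟩
  intro ρ h0 hi h1 he
  set Z := ∫ v, exp (q v / lam) ∂μ with hZd
  have iA : Integrable (fun u => (q u - lam * log (ρ u)) * ρ u) μ := by
    have := (hi.bdd_mul hq.aestronglyMeasurable hC).sub (he.const_mul lam)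
    refine this.congr (Filter.Eventually.of_forall fun u => ?_)
    simp only [Pi.sub_apply]; ring
  have iB1 : Integrable (fun u => lam * (exp (q u / lam) / Z - ρ u)) μ :=
    ((hint.div_const Z).sub hi).const_mul lam
  have iB2 : Integrable (fun u => lam * log Z * ρ u) μ := hi.const_mul _
  have iB : Integrable (fun u => lam * (exp (q u / lam) / Z - ρ u) + lam * log Z * ρ u) μ :=
    iB1.add iB2
  have eB : ∫ u, (lam * (exp (q u / lam) / Z - ρ u) + lam * log Z * ρ u) ∂μ = lam * log Z := by
    rw [integral_add iB1 iB2, integral_const_mul, integral_const_mul,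
      integral_sub (hint.div_const Z) hi, integral_div, h1, ← hZd, div_self hZ.ne']
    ring
  have key : ∀ u, (q u - lam * log (ρ u)) * ρ u
      = lam * ((log (exp (q u / lam) / Z) - log (ρ u)) * ρ u) + lam * log Z * ρ u := by
    intro u
    rw [log_div (exp_pos _).ne' hZ.ne', log_exp]
    field_simp
    ring
  have hle : (fun u => (q u - lam * log (ρ u)) * ρ u) ≤ᵐ[μ]
      (fun u => lam * (exp (q u / lam) / Z - ρ u) + lam * log Z * ρ u) := by
    filter_upwards [h0] with u hu
    rw [key u]
    have := (aux_pt (exp (q u / lam) / Z) (ρ u) (by positivity) hu).1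
    gcongr
  rw [← eB]
  refine ⟨integral_mono_ae iA iB hle, ?_⟩
  rw [integral_eq_iff_of_ae_le iA iB hle]
  constructor
  · intro h
    filter_upwards [h, h0] with u hu hu0
    rw [key u] at hu
    refine (aux_pt (exp (q u / lam) / Z) (ρ u) (by positivity) hu0).2 ?_
    have := add_right_cancel hu
    exact mul_left_cancel₀ hlam.ne' this
  · intro h
    filter_upwards [h] with u hu
    rw [key u, hu]
    ring

theorem aux_mulVec {d : ℕ} (P : Matrix (Fin d) (Fin d) ℝ) (h0 : ∀ i j, 0 ≤ P i j)
    (h1 : ∀ i, ∑ j, P i j = 1) (k : ℕ) (v : Fin d → ℝ) (c : ℝ) (hv : ∀ i, |v i| ≤ c) (i : Fin d) :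
    |(P ^ k).mulVec v i| ≤ c := by
  induction k generalizing i with
  | zero => simpa using hv i
  | succ k ih =>
    rw [pow_succ', ← Matrix.mulVec_mulVec]
    simp only [Matrix.mulVec, dotProduct] at ih ⊢
    calc |∑ j, P i j * ∑ l, (P ^ k) j l * v l| ≤ ∑ j, |P i j * ∑ l, (P ^ k) j l * v l| :=
          Finset.abs_sum_le_sum_abs _ _
      _ ≤ ∑ j, P i j * c := by
          refine Finset.sum_le_sum fun j _ => ?_
          rw [abs_mul, abs_of_nonneg (h0 i j)]
          exact mul_le_mul_of_nonneg_left (ih j) (h0 i j)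
      _ = c := by rw [← Finset.sum_mul, h1, one_mul]

theorem aux_tsum {d : ℕ} (P : Matrix (Fin d) (Fin d) ℝ) (h0 : ∀ i j, 0 ≤ P i j)
    (h1 : ∀ i, ∑ j, P i j = 1) (r : ℕ → Fin d → ℝ) (c : ℕ → ℝ) (hc : Summable c)
    (hr : ∀ k i, |r k i| ≤ c k) :
    ∑' k, (P ^ k).mulVec (r k) = r 0 + P.mulVec (∑' k, (P ^ k).mulVec (r (k + 1))) := by
  have hs : Summable fun k => (P ^ k).mulVec (r k) := by
    refine Pi.summable.2 fun i => ?_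
    exact Summable.of_norm_bounded hc fun k => aux_mulVec P h0 h1 k _ _ (hr k) i
  have hs' : Summable fun k => (P ^ k).mulVec (r (k + 1)) := by
    refine Pi.summable.2 fun i => ?_
    exact Summable.of_norm_bounded ((summable_nat_add_iff 1).2 hc)
      fun k => aux_mulVec P h0 h1 k _ _ (hr (k + 1)) i
  rw [hs.tsum_eq_zero_add]
  congr 1
  · simp
  · have := (LinearMap.toContinuousLinearMap (Matrix.mulVecLin P)).map_tsum hs'
    simp only [LinearMap.coe_toContinuousLinearMap', Matrix.mulVecLin_apply] at this
    rw [this]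
    refine tsum_congr fun k => ?_
    rw [Matrix.mulVec_mulVec, pow_succ']

theorem aux_integrable {ρ : EuclideanSpace ℝ (Fin ℓ) → ℝ} (h : (∫ u in U, ρ u) = 1) :
    IntegrableOn ρ U := by
  by_contra hn
  rw [integral_undef hn] at h
  exact zero_ne_one h

theorem aux_p_le (hstoch : ∀ u ∈ U, ∀ i, (∀ j, 0 ≤ p u i j) ∧ (∑ j, p u i j) = 1)
    (u) (hu : u ∈ U) (i j) : |p u i j| ≤ 1 := by
  obtain ⟨h0, h1⟩ := hstoch u hu i
  rw [abs_of_nonneg (h0 j), ← h1]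
  exact Finset.single_le_sum (fun j _ => h0 j) (Finset.mem_univ j)

theorem aux_p_int (hUmeas : MeasurableSet U)
    (hpmeas : ∀ i j, Measurable (fun u => p u i j))
    (hstoch : ∀ u ∈ U, ∀ i, (∀ j, 0 ≤ p u i j) ∧ (∑ j, p u i j) = 1)
    {ρ : EuclideanSpace ℝ (Fin ℓ) → ℝ} (h : IntegrableOn ρ U) (i j) :
    IntegrableOn (fun u => p u i j * ρ u) U := by
  refine Integrable.bdd_mul (c := 1) h (hpmeas i j).aestronglyMeasurable ?_
  exact (ae_restrict_iff' hUmeas).2 (Filter.Eventually.of_forall fun u hu =>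
    aux_p_le ℓ d U p hstoch u hu i j)

theorem aux_f_int (hUmeas : MeasurableSet U)
    (hfmeas : ∀ t i, Measurable (f t i))
    (b : ℕ → ℝ) (hb : ∀ t i, ∀ u ∈ U, |f t i u| ≤ b t)
    {ρ : EuclideanSpace ℝ (Fin ℓ) → ℝ} (h : IntegrableOn ρ U) (t i) :
    IntegrableOn (fun u => f t i u * ρ u) U := by
  refine Integrable.bdd_mul (c := b t) h (hfmeas t i).aestronglyMeasurable ?_
  exact (ae_restrict_iff' hUmeas).2 (Filter.Eventually.of_forall fun u hu => hb t i u hu)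

theorem aux_Jlam (hUmeas : MeasurableSet U)
    (hfmeas : ∀ t i, Measurable (f t i))
    (hpmeas : ∀ i j, Measurable (fun u => p u i j))
    (hstoch : ∀ u ∈ U, ∀ i, (∀ j, 0 ≤ p u i j) ∧ (∑ j, p u i j) = 1)
    (b : ℕ → ℝ) (hb : ∀ t i, ∀ u ∈ U, |f t i u| ≤ b t) (hbsum : Summable b)
    (hdis : ∀ t, dis t ∈ Set.Icc (0:ℝ) 1) (hdissum : Summable dis)
    (hlam : 0 < lam)
    (pol : Fin d → EuclideanSpace ℝ (Fin ℓ) → ℝ) (hpol : IsRegularControl ℓ d U pol) :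
    Jlam ℓ d U f p dis lam pol = Jcat ℓ d U f p dis lam pol pol := by
  have hi : ∀ i, IntegrableOn (pol i) U := fun i => aux_integrable ℓ U (hpol i).2.2.2.1
  refine aux_tsum (Pmat ℓ d U p pol) ?_ ?_ (rvec ℓ d U f dis lam pol)
    (fun k => b k + lam * dis k * ∑ i, |Hent ℓ U (pol i)|) ?_ ?_
  · intro i j
    refine setIntegral_nonneg hUmeas fun u hu => ?_
    exact mul_nonneg ((hstoch u hu i).1 j) ((hpol i).2.1 u hu)
  · intro i
    simp only [Pmat, Matrix.of_apply]
    rw [← integral_finsetSum _ fun j _ => aux_p_int ℓ d U p hUmeas hpmeas hstoch (hi i) i j,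
      ← (hpol i).2.2.2.1]
    refine setIntegral_congr_fun hUmeas fun u hu => ?_
    rw [← Finset.sum_mul, (hstoch u hu i).2, one_mul]
  · exact hbsum.add ((hdissum.mul_left lam).mul_right _)
  · intro k i
    refine (abs_add_le _ _).trans (add_le_add ?_ ?_)
    · calc |∫ u in U, f k i u * pol i u| ≤ ∫ u in U, |f k i u * pol i u| := abs_integral_le_integral_abs
        _ ≤ ∫ u in U, b k * pol i u := by
            refine setIntegral_mono_on (aux_f_int ℓ d U f hUmeas hfmeas b hb (hi i) k i).abs
              ((hi i).const_mul _) hUmeas fun u hu => ?_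
            have h0 := (hpol i).2.1 u hu
            rw [abs_mul, abs_of_nonneg h0]
            exact mul_le_mul_of_nonneg_right (hb k i u hu) h0
        _ = b k := by rw [integral_const_mul, (hpol i).2.2.2.1, mul_one]
    · rw [abs_mul, abs_of_nonneg (mul_nonneg hlam.le (hdis k).1)]
      refine mul_le_mul_of_nonneg_left ?_ (mul_nonneg hlam.le (hdis k).1)
      exact Finset.single_le_sum (f := fun i => |Hent ℓ U (pol i)|) (fun i _ => abs_nonneg _)
        (Finset.mem_univ i)

theorem aux_Jcat (hUmeas : MeasurableSet U)
    (hfmeas : ∀ t i, Measurable (f t i))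
    (hpmeas : ∀ i j, Measurable (fun u => p u i j))
    (hstoch : ∀ u ∈ U, ∀ i, (∀ j, 0 ≤ p u i j) ∧ (∑ j, p u i j) = 1)
    (b : ℕ → ℝ) (hb : ∀ t i, ∀ u ∈ U, |f t i u| ≤ b t) (hdis0 : dis 0 = 1)
    (pol' pol : Fin d → EuclideanSpace ℝ (Fin ℓ) → ℝ) (hpol : IsRegularControl ℓ d U pol') (i) :
    Jcat ℓ d U f p dis lam pol' pol i = ∫ u in U, (f 0 i u - lam * Real.log (pol' i u)
            + ∑ j, p u i j * Vlam ℓ d U f p dis lam pol j) * pol' i u := by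
  have hi : ∀ i, IntegrableOn (pol' i) U := fun i => aux_integrable ℓ U (hpol i).2.2.2.1
  generalize hV : Vlam ℓ d U f p dis lam pol = V
  have e : ∀ u, (f 0 i u - lam * Real.log (pol' i u) + ∑ j, p u i j * V j) * pol' i u
      = f 0 i u * pol' i u - lam * (pol' i u * log (pol' i u)) + ∑ j, p u i j * pol' i u * V j := by
    intro u
    rw [add_mul, Finset.sum_mul]
    congr 1
    · ring
    · exact Finset.sum_congr rfl fun j _ => by ring
  have I1 := aux_f_int ℓ d U f hUmeas hfmeas b hb (hi i) 0 i
  have I2 : IntegrableOn (fun u => lam * (pol' i u * log (pol' i u))) U :=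
    (hpol i).2.2.2.2.const_mul lam
  have I3 : ∀ j, IntegrableOn (fun u => p u i j * pol' i u * V j) U := fun j =>
    (aux_p_int ℓ d U p hUmeas hpmeas hstoch (hi i) i j).mul_const _
  have I12 : IntegrableOn (fun u => f 0 i u * pol' i u - lam * (pol' i u * log (pol' i u))) U :=
    I1.sub I2
  simp only [e]
  rw [integral_add I12 (integrable_finsetSum _ fun j _ => I3 j), integral_sub I1 I2,
    integral_finsetSum _ fun j _ => I3 j, integral_const_mul]
  simp only [Jcat, rvec, Hent, hdis0, hV, Matrix.mulVec, dotProduct, Pmat, Matrix.of_apply,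
    integral_mul_const]
  ring

/-- fixed-point characterization of relaxed equilibria of the discrete-time
entropy-regularized MDP: `pol` is a relaxed equilibrium iff each `pol i` maximizes
`ρ ↦ ∫_U (f(0,i,u) - λ ln ρ(u) + p^u_i·V_λ^pol) ρ(u) du` over densities, iff each `pol i`
equals (a.e.) the Gibbs density `Γ_λ(V_λ^pol, i)`. -/
theorem relaxed_equilibrium_iff_gibbs_fixed_point
    (hUmeas : MeasurableSet U) (hUc : IsCompact U) (hUpos : 0 < volume U)
    (hfmeas : ∀ t i, Measurable (f t i))
    (hpmeas : ∀ i j, Measurable (fun u => p u i j))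
    (hstoch : ∀ u ∈ U, ∀ i, (∀ j, 0 ≤ p u i j) ∧ (∑ j, p u i j) = 1)
    (b : ℕ → ℝ) (hb : ∀ t i, ∀ u ∈ U, |f t i u| ≤ b t) (hbsum : Summable b)
    (hdis : ∀ t, dis t ∈ Set.Icc (0:ℝ) 1) (hdis0 : dis 0 = 1) (hdissum : Summable dis)
    (hlam : 0 < lam)
    (pol : Fin d → EuclideanSpace ℝ (Fin ℓ) → ℝ) (hpol : IsRegularControl ℓ d U pol) :
    (IsRelaxedEquilibrium ℓ d U f p dis lam pol ↔
      (∀ i, ∀ ρ : EuclideanSpace ℝ (Fin ℓ) → ℝ, Measurable ρ → (∀ u ∈ U, 0 ≤ ρ u) →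
        (∀ u, u ∉ U → ρ u = 0) → (∫ u in U, ρ u) = 1 →
        IntegrableOn (fun u => ρ u * Real.log (ρ u)) U →
        (∫ u in U, (f 0 i u - lam * Real.log (ρ u)
            + ∑ j, p u i j * Vlam ℓ d U f p dis lam pol j) * ρ u)
          ≤ ∫ u in U, (f 0 i u - lam * Real.log (pol i u)
            + ∑ j, p u i j * Vlam ℓ d U f p dis lam pol j) * pol i u))
    ∧
    ((∀ i, ∀ ρ : EuclideanSpace ℝ (Fin ℓ) → ℝ, Measurable ρ → (∀ u ∈ U, 0 ≤ ρ u) →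
        (∀ u, u ∉ U → ρ u = 0) → (∫ u in U, ρ u) = 1 →
        IntegrableOn (fun u => ρ u * Real.log (ρ u)) U →
        (∫ u in U, (f 0 i u - lam * Real.log (ρ u)
            + ∑ j, p u i j * Vlam ℓ d U f p dis lam pol j) * ρ u)
          ≤ ∫ u in U, (f 0 i u - lam * Real.log (pol i u)
            + ∑ j, p u i j * Vlam ℓ d U f p dis lam pol j) * pol i u) ↔
      (∀ i, ∀ᵐ u ∂(volume.restrict U), pol i u =
        Real.exp ((f 0 i u + ∑ j, p u i j * Vlam ℓ d U f p dis lam pol j) / lam)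
          / ∫ v in U, Real.exp ((f 0 i v + ∑ j, p v i j * Vlam ℓ d U f p dis lam pol j) / lam))) := by
  classical
  have hi : ∀ i, IntegrableOn (pol i) U := fun i => aux_integrable ℓ U (hpol i).2.2.2.1
  have hJ := aux_Jlam ℓ d U f p dis lam hUmeas hfmeas hpmeas hstoch b hb hbsum hdis hdissum hlam
    pol hpol
  have hC := fun pol' h i => aux_Jcat ℓ d U f p dis lam hUmeas hfmeas hpmeas hstoch b hb hdis0
    pol' pol h i
  constructor
  · constructor
    · rintro ⟨-, h⟩ i ρ m1 m2 m3 m4 m5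
      have hreg : IsRegularControl ℓ d U (Function.update pol i ρ) := by
        intro k
        by_cases hk : k = i
        · subst hk
          rw [Function.update_self]
          exact ⟨m1, m2, m3, m4, m5⟩
        · rw [Function.update_of_ne hk]
          exact hpol k
      have := h _ hreg i
      rw [hJ, hC _ hreg, hC _ hpol, Function.update_self] at this
      exact this
    · intro h
      refine ⟨hpol, fun pol' h' i => ?_⟩
      rw [hJ, hC _ h', hC _ hpol]
      obtain ⟨m1, m2, m3, m4, m5⟩ := h' i
      exact h i (pol' i) m1 m2 m3 m4 m5
  · generalize Vlam ℓ d U f p dis lam pol = V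
    refine forall_congr' fun i => ?_
    haveI : IsFiniteMeasure (volume.restrict U) := ⟨by
      rw [Measure.restrict_apply_univ]; exact hUc.measure_lt_top⟩
    haveI : NeZero (volume.restrict U) := ⟨by
      rw [Ne, Measure.restrict_eq_zero]; exact hUpos.ne'⟩
    have hqm : Measurable fun u => f 0 i u + ∑ j, p u i j * V j :=
      (hfmeas 0 i).add (Finset.measurable_sum _ fun j _ => (hpmeas i j).mul_const _)
    have hqb : ∀ u ∈ U, |f 0 i u + ∑ j, p u i j * V j| ≤ b 0 + ∑ j, |V j| := by
      intro u hu
      refine (abs_add_le _ _).trans (add_le_add (hb 0 i u hu) ?_)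
      refine (Finset.abs_sum_le_sum_abs _ _).trans (Finset.sum_le_sum fun j _ => ?_)
      rw [abs_mul]
      exact mul_le_of_le_one_left (abs_nonneg _) (aux_p_le ℓ d U p hstoch u hu i j)
    have e : ∀ (ρ : EuclideanSpace ℝ (Fin ℓ) → ℝ) u,
        f 0 i u - lam * Real.log (ρ u) + ∑ j, p u i j * V j
        = (f 0 i u + ∑ j, p u i j * V j) - lam * Real.log (ρ u) := fun ρ u => by ring
    simp only [e]
    generalize hq : (fun u => f 0 i u + ∑ j, p u i j * V j) = q at hqm
    have hq' : ∀ u, f 0 i u + ∑ j, p u i j * V j = q u := fun u => by rw [← hq]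
    simp only [hq'] at hqb ⊢
    obtain ⟨hint, hZ, H⟩ := aux_gibbs (volume.restrict U) q _ lam hlam hqm
      ((ae_restrict_iff' hUmeas).2 (Filter.Eventually.of_forall hqb))
    have H' := fun (ρ : EuclideanSpace ℝ (Fin ℓ) → ℝ) (h0 : ∀ u ∈ U, 0 ≤ ρ u) h1 h2 => H ρ
      ((ae_restrict_iff' hUmeas).2 (Filter.Eventually.of_forall h0)) (aux_integrable ℓ U h1) h1 h2
    have Hp := H' (pol i) (hpol i).2.1 (hpol i).2.2.2.1 (hpol i).2.2.2.2
    rw [← Hp.2]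
    constructor
    · intro h
      refine le_antisymm Hp.1 ?_
      set Z := ∫ v in U, exp (q v / lam) with hZd
      have hge : ∀ u ∈ U, U.indicator (fun u => exp (q u / lam) / Z) u = exp (q u / lam) / Z :=
        fun u hu => Set.indicator_of_mem hu _
      have g0 : ∀ u ∈ U, 0 ≤ U.indicator (fun u => exp (q u / lam) / Z) u := by
        intro u hu
        rw [hge u hu]; positivity
      have g1 : (∫ u in U, U.indicator (fun u => exp (q u / lam) / Z) u) = 1 := by
        rw [setIntegral_congr_fun hUmeas hge, integral_div, ← hZd, div_self hZ.ne']
      have g2 : IntegrableOn (fun u => U.indicator (fun u => exp (q u / lam) / Z) u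
          * log (U.indicator (fun u => exp (q u / lam) / Z) u)) U := by
        have hb1 : IntegrableOn (fun u => (q u / lam - log Z) * (exp (q u / lam) / Z)) U := by
          refine Integrable.bdd_mul (c := (b 0 + ∑ j, |V j|) / lam + |log Z|)
            (hint.div_const Z) (by fun_prop) ?_
          refine (ae_restrict_iff' hUmeas).2 (Filter.Eventually.of_forall fun u hu => ?_)
          refine (norm_sub_le _ _).trans (add_le_add ?_ le_rfl)
          rw [Real.norm_eq_abs, abs_div, abs_of_pos hlam]
          exact div_le_div_of_nonneg_right (hqb u hu) hlam.le
        refine hb1.congr_fun (fun u hu => ?_) hUmeas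
        simp only
        rw [hge u hu, log_div (exp_pos _).ne' hZ.ne', log_exp, mul_comm]
      have h3 := h _ ((by fun_prop : Measurable fun u => exp (q u / lam) / Z).indicator hUmeas) g0
        (fun u hu => Set.indicator_of_notMem hu _) g1 g2
      rw [(H' _ g0 g1 g2).2.2 ((ae_restrict_iff' hUmeas).2 (Filter.Eventually.of_forall hge))] at h3
      exact h3
    · intro h ρ _ m2 _ m4 m5
      rw [h]
      exact (H' ρ m2 m4 m5).1

end
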